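/- Let n ≥ 2 and G = 𝔹^n \ {0}. Then for all y, z ∈ G, δ_G(y,z) = max{ δ_{𝔹^n}(y,z), log(1 + |y−z|/(|z|(1−|y|))), log(1 + |y−z|/(|y|(1−|z|))) }, where δ_{𝔹^n}(y,z) = sup over a, b ∈ S^{n−1}(0,1) of log(1 + |a−b||y−z| / (|a−y||z−b|)). -/

import Mathlib

/-- Seittenranta's distance in the punctured unit ball `𝔹ⁿ \ {0}`, whose boundary is
`S^{n−1}(0,1) ∪ {0}`:
`δ_G(y,z) = sup_{a,b ∈ ∂G} log (1 + |a−b||y−z| / (|a−y||z−b|))`. -/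
noncomputable def seitPuncturedBall {n : ℕ} (y z : EuclideanSpace ℝ (Fin n)) : ℝ :=
  sSup {t : ℝ |
    ∃ a ∈ Metric.sphere (0 : EuclideanSpace ℝ (Fin n)) 1 ∪ {0},
    ∃ b ∈ Metric.sphere (0 : EuclideanSpace ℝ (Fin n)) 1 ∪ {0},
    t = Real.log (1 + dist a b * dist y z / (dist a y * dist z b))}

/-- Seittenranta's distance in the unit ball `𝔹ⁿ`:
`δ_{𝔹ⁿ}(y,z) = sup_{a,b ∈ S^{n−1}(0,1)} log (1 + |a−b||y−z| / (|a−y||z−b|))`. -/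
noncomputable def seitUnitBall {n : ℕ} (y z : EuclideanSpace ℝ (Fin n)) : ℝ :=
  sSup {t : ℝ |
    ∃ a ∈ Metric.sphere (0 : EuclideanSpace ℝ (Fin n)) 1,
    ∃ b ∈ Metric.sphere (0 : EuclideanSpace ℝ (Fin n)) 1,
    t = Real.log (1 + dist a b * dist y z / (dist a y * dist z b))}

section CrossRatioBounds

variable {E : Type*} [NormedAddCommGroup E]

lemma one_sub_norm_le_dist_of_mem_sphere {a : E} (ha : a ∈ Metric.sphere (0 : E) 1) (y : E) :
    1 - ‖y‖ ≤ dist a y := by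
  rw [mem_sphere_zero_iff_norm] at ha
  rw [dist_eq_norm, ← ha]
  exact norm_sub_norm_le a y

lemma inv_norm_smul_self_mem_sphere [NormedSpace ℝ E] {y : E} (hy : y ≠ 0) :
    ‖y‖⁻¹ • y ∈ Metric.sphere (0 : E) 1 := by
  rw [mem_sphere_zero_iff_norm]
  exact norm_smul_inv_norm (𝕜 := ℝ) hy

lemma dist_inv_norm_smul_self [NormedSpace ℝ E] {y : E} (hy : y ≠ 0) (hy1 : ‖y‖ ≤ 1) :
    dist (‖y‖⁻¹ • y) y = 1 - ‖y‖ := by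
  have hpos : 0 < ‖y‖ := norm_pos_iff.mpr hy
  have h : ‖y‖⁻¹ • y - y = (‖y‖⁻¹ - 1) • y := by rw [sub_smul, one_smul]
  have hinv : 0 ≤ ‖y‖⁻¹ - 1 := sub_nonneg.mpr ((one_le_inv₀ hpos).mpr hy1)
  rw [dist_eq_norm, h, norm_smul, Real.norm_of_nonneg hinv]
  field_simp

lemma log_one_add_div_le_log_one_add_div {p q c d : ℝ} (hp : 0 ≤ p) (hpq : p ≤ q)
    (hc : 0 < c) (hcd : c ≤ d) : Real.log (1 + p / d) ≤ Real.log (1 + q / c) := by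
  have hd : 0 < d := hc.trans_le hcd
  apply Real.log_le_log (by positivity)
  gcongr
  exact hp.trans hpq

lemma log_cross_ratio_le_of_mem_sphere {y z a b : E} (hy : ‖y‖ < 1) (hz : ‖z‖ < 1)
    (ha : a ∈ Metric.sphere (0 : E) 1) (hb : b ∈ Metric.sphere (0 : E) 1) :
    Real.log (1 + dist a b * dist y z / (dist a y * dist z b)) ≤
      Real.log (1 + 2 * dist y z / ((1 - ‖y‖) * (1 - ‖z‖))) := by
  have hy' : 0 < 1 - ‖y‖ := sub_pos.mpr hy
  have hz' : 0 < 1 - ‖z‖ := sub_pos.mpr hz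
  have hab : dist a b ≤ 2 := by
    have h := dist_triangle_right a b 0
    rw [Metric.mem_sphere] at ha hb
    linarith
  have hzb : 1 - ‖z‖ ≤ dist z b := by
    rw [dist_comm]; exact one_sub_norm_le_dist_of_mem_sphere hb z
  apply log_one_add_div_le_log_one_add_div (by positivity)
  · gcongr
  · positivity
  · exact mul_le_mul (one_sub_norm_le_dist_of_mem_sphere ha y) hzb hz'.le dist_nonneg

lemma log_cross_ratio_zero_right_le {y z a : E} (hy : ‖y‖ < 1) (hz : z ≠ 0)
    (ha : a ∈ Metric.sphere (0 : E) 1) :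
    Real.log (1 + dist a 0 * dist y z / (dist a y * dist z 0)) ≤
      Real.log (1 + dist y z / (‖z‖ * (1 - ‖y‖))) := by
  have hy' : 0 < 1 - ‖y‖ := sub_pos.mpr hy
  have hz' : 0 < ‖z‖ := norm_pos_iff.mpr hz
  rw [Metric.mem_sphere.mp ha, one_mul, dist_zero_right, mul_comm (dist a y)]
  apply log_one_add_div_le_log_one_add_div dist_nonneg le_rfl (by positivity)
  gcongr
  exact one_sub_norm_le_dist_of_mem_sphere ha y

lemma log_cross_ratio_swap (y z a b : E) :
    Real.log (1 + dist a b * dist y z / (dist a y * dist z b)) =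
      Real.log (1 + dist b a * dist z y / (dist b z * dist y a)) := by
  rw [dist_comm b a, dist_comm z y, dist_comm b z, dist_comm y a, mul_comm (dist a y)]

lemma log_cross_ratio_zero_left_le {y z b : E} (hy : y ≠ 0) (hz : ‖z‖ < 1)
    (hb : b ∈ Metric.sphere (0 : E) 1) :
    Real.log (1 + dist 0 b * dist y z / (dist 0 y * dist z b)) ≤
      Real.log (1 + dist y z / (‖y‖ * (1 - ‖z‖))) := by
  rw [log_cross_ratio_swap, dist_comm y z]
  exact log_cross_ratio_zero_right_le hz hy hb

lemma log_cross_ratio_inv_norm_smul_zero [NormedSpace ℝ E] {y : E} (z : E) (hy : y ≠ 0)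
    (hy1 : ‖y‖ ≤ 1) :
    Real.log (1 + dist (‖y‖⁻¹ • y) 0 * dist y z / (dist (‖y‖⁻¹ • y) y * dist z 0)) =
      Real.log (1 + dist y z / (‖z‖ * (1 - ‖y‖))) := by
  rw [Metric.mem_sphere.mp (inv_norm_smul_self_mem_sphere hy), dist_inv_norm_smul_self hy hy1,
    one_mul, dist_zero_right, mul_comm (1 - ‖y‖)]

end CrossRatioBounds

/-- For `G = 𝔹ⁿ \ {0}` (`n ≥ 2`) and `y, z ∈ G`,
`δ_G(y,z) = max { δ_{𝔹ⁿ}(y,z), log (1 + |y−z|/(|z|(1−|y|))), log (1 + |y−z|/(|y|(1−|z|))) }`. -/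
theorem seittenranta_punctured_ball_formula
    (n : ℕ) (hn : 2 ≤ n) (y z : EuclideanSpace ℝ (Fin n))
    (hy : y ∈ Metric.ball (0 : EuclideanSpace ℝ (Fin n)) 1 \ {0})
    (hz : z ∈ Metric.ball (0 : EuclideanSpace ℝ (Fin n)) 1 \ {0}) :
    seitPuncturedBall y z =
      max (seitUnitBall y z)
        (max (Real.log (1 + dist y z / (‖z‖ * (1 - ‖y‖))))
             (Real.log (1 + dist y z / (‖y‖ * (1 - ‖z‖))))) := by
  obtain ⟨hy1, hy0⟩ := hy
  obtain ⟨hz1, hz0⟩ := hz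
  rw [mem_ball_zero_iff] at hy1 hz1
  rw [Set.mem_singleton_iff] at hy0 hz0
  have hys := inv_norm_smul_self_mem_sphere hy0
  have hzs := inv_norm_smul_self_mem_sphere hz0
  have hle : ∀ t ∈ {t : ℝ |
      ∃ a ∈ Metric.sphere (0 : EuclideanSpace ℝ (Fin n)) 1 ∪ {0},
      ∃ b ∈ Metric.sphere (0 : EuclideanSpace ℝ (Fin n)) 1 ∪ {0},
      t = Real.log (1 + dist a b * dist y z / (dist a y * dist z b))},
      t ≤ max (seitUnitBall y z)
        (max (Real.log (1 + dist y z / (‖z‖ * (1 - ‖y‖))))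
             (Real.log (1 + dist y z / (‖y‖ * (1 - ‖z‖))))) := by
    rintro t ⟨a, ha | rfl, b, hb | rfl, rfl⟩
    · refine le_max_of_le_left (le_csSup ?_ ⟨a, ha, b, hb, rfl⟩)
      refine ⟨Real.log (1 + 2 * dist y z / ((1 - ‖y‖) * (1 - ‖z‖))), ?_⟩
      rintro _ ⟨a', ha', b', hb', rfl⟩
      exact log_cross_ratio_le_of_mem_sphere hy1 hz1 ha' hb'
    · exact le_max_of_le_right (le_max_of_le_left (log_cross_ratio_zero_right_le hy1 hz0 ha))
    · exact le_max_of_le_right (le_max_of_le_right (log_cross_ratio_zero_left_le hy0 hz1 hb))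
    · refine le_max_of_le_right (le_max_of_le_left ?_)
      have hy' : 0 ≤ 1 - ‖y‖ := sub_nonneg.mpr hy1.le
      rw [dist_self, zero_mul, zero_div, add_zero, Real.log_one]
      exact Real.log_nonneg (le_add_of_nonneg_right (by positivity))
  apply le_antisymm
  · exact csSup_le ⟨_, 0, Or.inr rfl, 0, Or.inr rfl, rfl⟩ hle
  · refine max_le (csSup_le_csSup ⟨_, hle⟩ ⟨_, _, hys, _, hys, rfl⟩ ?_) (max_le ?_ ?_)
    · rintro t ⟨a, ha, b, hb, rfl⟩
      exact ⟨a, Or.inl ha, b, Or.inl hb, rfl⟩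
    · exact le_csSup ⟨_, hle⟩ ⟨_, Or.inl hys, 0, Or.inr rfl,
        (log_cross_ratio_inv_norm_smul_zero z hy0 hy1.le).symm⟩
    · refine le_csSup ⟨_, hle⟩ ⟨0, Or.inr rfl, _, Or.inl hzs, ?_⟩
      rw [log_cross_ratio_swap, log_cross_ratio_inv_norm_smul_zero y hz0 hz1.le, dist_comm z y]
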